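/- Let p be a prime and G a non-cyclic group of order pⁿ (n ≥ 1). Then σ₁(G) = 2 + 11/|G| if and only if G is isomorphic to ℤ/2 × ℤ/4. -/

import Mathlib

noncomputable def sigma1 (G : Type*) [Group G] : ℚ :=
  (∑ᶠ H : Subgroup G, (Nat.card H : ℚ)) / Nat.card G

noncomputable def subgroupsOfCard (G : Type*) [Group G] [Finite G] (k : ℕ) :
    Finset (Subgroup G) :=
  (Set.toFinite {H : Subgroup G | Nat.card H = k}).toFinset

section

variable {G : Type*} [Group G] [Finite G]

theorem mem_subgroupsOfCard {k : ℕ} {H : Subgroup G} :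
    H ∈ subgroupsOfCard G k ↔ Nat.card H = k := by
  simp [subgroupsOfCard]

theorem card_subgroupsOfCard_one : (subgroupsOfCard G 1).card = 1 := by
  rw [Finset.card_eq_one]
  refine ⟨⊥, Finset.ext fun H => ?_⟩
  rw [mem_subgroupsOfCard, Finset.mem_singleton, Subgroup.card_eq_one]

theorem card_subgroupsOfCard_card : (subgroupsOfCard G (Nat.card G)).card = 1 := by
  rw [Finset.card_eq_one]
  refine ⟨⊤, Finset.ext fun H => ?_⟩
  rw [mem_subgroupsOfCard, Finset.mem_singleton, Subgroup.card_eq_iff_eq_top]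

theorem finsum_card_subgroup_eq {p n : ℕ} (hp : p.Prime) (hcard : Nat.card G = p ^ n) :
    ∑ᶠ H : Subgroup G, (Nat.card H : ℚ) =
      ((∑ i ∈ Finset.range (n + 1), (subgroupsOfCard G (p ^ i)).card * p ^ i : ℕ) : ℚ) := by
  classical
  have := Fintype.ofFinite (Subgroup G)
  rw [finsum_eq_sum_of_fintype, ← Nat.cast_sum, Nat.cast_inj]
  have hmaps : ∀ H ∈ (Finset.univ : Finset (Subgroup G)),
      Nat.card H ∈ (Finset.range (n + 1)).image (p ^ ·) := by
    intro H _
    obtain ⟨k, hk, hH⟩ := (Nat.dvd_prime_pow hp).1 (hcard ▸ H.card_subgroup_dvd_card)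
    exact Finset.mem_image.2 ⟨k, Finset.mem_range.2 (by lia), hH.symm⟩
  rw [← Finset.sum_fiberwise_of_maps_to hmaps,
    Finset.sum_image fun a _ b _ h => Nat.pow_right_injective hp.two_le h]
  refine Finset.sum_congr rfl fun i _ => ?_
  rw [← smul_eq_mul]
  have : subgroupsOfCard G (p ^ i) = Finset.univ.filter fun H : Subgroup G => Nat.card H = p ^ i := by
    ext H
    simp [mem_subgroupsOfCard]
  rw [this]
  exact Finset.sum_eq_card_nsmul fun H hH => (Finset.mem_filter.1 hH).2

theorem one_le_card_subgroupsOfCard {p n i : ℕ} (hp : p.Prime) (hcard : Nat.card G = p ^ n)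
    (hi : i ≤ n) : 1 ≤ (subgroupsOfCard G (p ^ i)).card := by
  have := Fact.mk hp
  obtain ⟨K, hK⟩ := Sylow.exists_subgroup_card_pow_prime (G := G) p (hcard ▸ pow_dvd_pow p hi)
  exact Finset.card_pos.2 ⟨K, mem_subgroupsOfCard.2 hK⟩

theorem succ_le_card_subgroupsOfCard_of_not_isCyclic {p n : ℕ} (hp : p.Prime)
    (hcard : Nat.card G = p ^ (n + 1)) (hnc : ¬IsCyclic G) :
    p + 1 ≤ (subgroupsOfCard G (p ^ n)).card := by
  classical
  have := Fact.mk hp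
  have := Fintype.ofFinite G
  have hcover : (Finset.univ : Finset G) ⊆ insert 1 ((subgroupsOfCard G (p ^ n)).biUnion
      fun H => (Finset.univ.filter (· ∈ H)).erase 1) := by
    intro x _
    obtain ⟨k, hk, hx⟩ := (Nat.dvd_prime_pow hp).1 (hcard ▸ orderOf_dvd_natCard x)
    have hkn : k ≠ n + 1 := by
      rintro rfl
      exact hnc (isCyclic_of_orderOf_eq_card x (hx.trans hcard.symm))
    obtain ⟨K, hK, hle⟩ := Sylow.exists_subgroup_card_pow_prime_le p (m := n)
      (hcard ▸ pow_dvd_pow p n.le_succ) (Subgroup.zpowers x)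
      ((Nat.card_zpowers x).trans hx) (by lia)
    by_cases hx1 : x = 1
    · simp [hx1]
    · simp only [Finset.mem_insert, Finset.mem_biUnion, Finset.mem_erase, Finset.mem_filter,
        Finset.mem_univ, true_and, mem_subgroupsOfCard]
      exact Or.inr ⟨K, hK, hx1, hle (Subgroup.mem_zpowers x)⟩
  have h1 := Finset.card_le_card hcover
  have h2 := Finset.card_biUnion_le_card_mul (subgroupsOfCard G (p ^ n))
    (fun H => ((Finset.univ : Finset G).filter (· ∈ H)).erase 1) (p ^ n - 1) (by
      intro H hH
      rw [Finset.card_erase_of_mem (by simp [H.one_mem]), ← mem_subgroupsOfCard.1 hH,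
        Nat.card_eq_fintype_card, Fintype.card_subtype])
  have h3 := Finset.card_insert_le (1 : G) ((subgroupsOfCard G (p ^ n)).biUnion
    fun H => (Finset.univ.filter (· ∈ H)).erase 1)
  rw [Finset.card_univ, ← Nat.card_eq_fintype_card, hcard] at h1
  by_contra! hlt
  have h4 : (subgroupsOfCard G (p ^ n)).card * (p ^ n - 1) ≤ p * (p ^ n - 1) :=
    Nat.mul_le_mul_right _ (by lia)
  have h5 : p ^ (n + 1) ≤ p * (p ^ n - 1) + 1 := by lia
  rw [Nat.mul_sub, pow_succ', mul_one] at h5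
  have h6 : p * 1 ≤ p * p ^ n := Nat.mul_le_mul_left _ (Nat.one_le_pow _ _ hp.pos)
  have := hp.two_le
  lia

theorem card_mul_add_le_of_forall_le {p : ℕ} (hp : p.Prime) (K : Subgroup G)
    (F : Finset (Subgroup G)) (hle : ∀ H ∈ F, K ≤ H)
    (hF : ∀ H ∈ F, Nat.card H = p * Nat.card K) :
    F.card * (p * Nat.card K - Nat.card K) + Nat.card K ≤ Nat.card G := by
  classical
  have := Fintype.ofFinite G
  have hK : (Finset.univ.filter (· ∈ K)).card = Nat.card K := by
    rw [Nat.card_eq_fintype_card, Fintype.card_subtype]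
  have hdisj : (F : Set (Subgroup G)).PairwiseDisjoint
      fun H => Finset.univ.filter (· ∈ H) \ Finset.univ.filter (· ∈ K) := by
    intro H hH H' hH' hne
    refine Finset.disjoint_left.2 fun x hx hx' => hne ?_
    simp only [Finset.mem_sdiff, Finset.mem_filter, Finset.mem_univ, true_and] at hx hx'
    obtain ⟨d, hd⟩ := Subgroup.card_dvd_of_le (le_inf (hle H hH) (hle H' hH'))
    have hdp : d ∣ p := by
      have h := Subgroup.card_dvd_of_le (inf_le_left : H ⊓ H' ≤ H)
      rw [hd, hF H hH, mul_comm p] at h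
      exact Nat.dvd_of_mul_dvd_mul_left Nat.card_pos h
    rcases (Nat.dvd_prime hp).1 hdp with rfl | rfl
    · have := Subgroup.eq_of_le_of_card_ge (le_inf (hle H hH) (hle H' hH')) (by lia)
      exact absurd (this ▸ Subgroup.mem_inf.2 ⟨hx.1, hx'.1⟩ : x ∈ K) hx.2
    · rw [mul_comm] at hd
      exact (Subgroup.eq_of_le_of_card_ge inf_le_left ((hF H hH).trans hd.symm).le).symm.trans
        (Subgroup.eq_of_le_of_card_ge inf_le_right ((hF H' hH').trans hd.symm).le)
  have hsum := Finset.card_biUnion hdisj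
  rw [Finset.sum_const_nat (m := p * Nat.card K - Nat.card K)] at hsum
  · rw [← hsum, ← hK, ← Finset.card_union_of_disjoint, Nat.card_eq_fintype_card]
    · exact Finset.card_le_univ _
    · exact Finset.disjoint_biUnion_left _ _ _ |>.2 fun H _ => Finset.sdiff_disjoint
  · intro H hH
    rw [Finset.card_sdiff_of_subset (Finset.monotone_filter_right _ fun x _ hx => hle H hH hx),
      hK, ← hF H hH, Nat.card_eq_fintype_card (α := H), Fintype.card_subtype]

theorem card_subgroupsOfCard_two [Fintype G] [DecidableEq G] :
    (subgroupsOfCard G 2).card = (Finset.univ.filter fun x : G => orderOf x = 2).card := by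
  symm
  refine Finset.card_bij (fun x _ => Subgroup.zpowers x) ?_ ?_ ?_
  · intro x hx
    rw [mem_subgroupsOfCard, Nat.card_zpowers]
    exact (Finset.mem_filter.1 hx).2
  · intro x hx y hy h
    have hx := (Finset.mem_filter.1 hx).2
    have hy := (Finset.mem_filter.1 hy).2
    have hxy : x ∈ Subgroup.zpowers y := h ▸ Subgroup.mem_zpowers x
    rw [mem_zpowers_iff_mem_range_orderOf, hy] at hxy
    simp only [Finset.mem_image, Finset.mem_range] at hxy
    obtain ⟨k, hk, rfl⟩ := hxy
    interval_cases k
    · simp at hx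
    · simp
  · intro H hH
    rw [mem_subgroupsOfCard] at hH
    obtain ⟨x, hx⟩ := exists_prime_orderOf_dvd_card' (G := H) 2 (by rw [hH])
    refine ⟨x, by simpa using hx, ?_⟩
    refine Subgroup.eq_of_le_of_card_ge (by simp) ?_
    rw [hH, Nat.card_zpowers, Subgroup.orderOf_coe, hx]

theorem card_subgroupsOfCard_four_le {z : G} (hcard : Nat.card G = 8) (hz : orderOf z = 2)
    (h : ∀ H : Subgroup G, Nat.card H = 4 → z ∈ H) : (subgroupsOfCard G 4).card ≤ 3 := by
  have := card_mul_add_le_of_forall_le Nat.prime_two (Subgroup.zpowers z) (subgroupsOfCard G 4)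
    (fun H hH => by simpa using h H (mem_subgroupsOfCard.1 hH))
    (fun H hH => by rw [mem_subgroupsOfCard.1 hH, Nat.card_zpowers, hz])
  rw [Nat.card_zpowers, hz, hcard] at this
  lia

theorem orderOf_mem_of_card_eight (hcard : Nat.card G = 8) (hnc : ¬IsCyclic G) (x : G) :
    orderOf x = 1 ∨ orderOf x = 2 ∨ orderOf x = 4 := by
  have hd : orderOf x ∣ 2 ^ 3 := by simpa [hcard] using orderOf_dvd_natCard x
  obtain ⟨k, hk, hx⟩ := (Nat.dvd_prime_pow Nat.prime_two).1 hd
  have : k ≠ 3 := by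
    rintro rfl
    exact hnc (isCyclic_of_orderOf_eq_card x (by rw [hx, hcard]; rfl))
  interval_cases k <;> simp_all

theorem nonempty_mulEquiv_of_commute (hcard : Nat.card G = 8) {a b : G} (ha : orderOf a = 4)
    (hb : orderOf b = 2) (hba : b ∉ Subgroup.zpowers a) (hc : Commute a b) :
    Nonempty (G ≃* Multiplicative (ZMod 2) × Multiplicative (ZMod 4)) := by
  classical
  let e₂ : Multiplicative (ZMod 2) ≃* Subgroup.zpowers b :=
    mulEquivOfCyclicCardEq (by simp [Nat.card_zpowers, hb])
  let e₄ : Multiplicative (ZMod 4) ≃* Subgroup.zpowers a :=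
    mulEquivOfCyclicCardEq (by simp [Nat.card_zpowers, ha])
  have hcomm : ∀ (x : Subgroup.zpowers b) (y : Subgroup.zpowers a),
      Commute ((Subgroup.zpowers b).subtype x) ((Subgroup.zpowers a).subtype y) := by
    rintro ⟨_, k, rfl⟩ ⟨_, l, rfl⟩
    exact (hc.symm.zpow_zpow k l)
  let f := (Subgroup.zpowers b).subtype.noncommCoprod (Subgroup.zpowers a).subtype hcomm
  have hinj : Function.Injective f := by
    refine (MonoidHom.noncommCoprod_injective _ _ hcomm).2
      ⟨Subtype.val_injective, Subtype.val_injective, ?_⟩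
    rw [Subgroup.range_subtype, Subgroup.range_subtype, Subgroup.disjoint_def]
    intro x hx hxa
    rw [mem_zpowers_iff_mem_range_orderOf, hb] at hx
    simp only [Finset.mem_image, Finset.mem_range] at hx
    obtain ⟨k, hk, rfl⟩ := hx
    interval_cases k
    · simp
    · exact absurd (by simpa using hxa) hba
  have hbij : Function.Bijective f := by
    rw [Nat.bijective_iff_injective_and_card]
    refine ⟨hinj, ?_⟩
    rw [Nat.card_prod, Nat.card_zpowers, Nat.card_zpowers, ha, hb, hcard]
  exact ⟨(MulEquiv.ofBijective f hbij).symm.trans (MulEquiv.prodCongr e₂ e₄).symm⟩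

theorem nonempty_mulEquiv_of_card_involutions (hcard : Nat.card G = 8) (hnc : ¬IsCyclic G)
    (h2 : (subgroupsOfCard G 2).card = 3) :
    Nonempty (G ≃* Multiplicative (ZMod 2) × Multiplicative (ZMod 4)) := by
  classical
  have := Fintype.ofFinite G
  rw [card_subgroupsOfCard_two] at h2
  obtain ⟨a, ha⟩ : ∃ a : G, orderOf a = 4 := by
    by_contra! hno
    have : (Finset.univ.filter fun x : G => orderOf x = 2) = Finset.univ.erase 1 := by
      ext x
      have := orderOf_mem_of_card_eight hcard hnc x
      have := hno x
      rw [orderOf_eq_one_iff] at *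
      simp only [Finset.mem_filter, Finset.mem_univ, true_and, Finset.mem_erase, and_true]
      constructor
      · rintro h rfl
        simp at h
      · tauto
    rw [this, Finset.card_erase_of_mem (Finset.mem_univ _), Finset.card_univ,
      ← Nat.card_eq_fintype_card, hcard] at h2
    simp at h2
  obtain ⟨b, hb, hba⟩ : ∃ b : G, orderOf b = 2 ∧ b ∉ Subgroup.zpowers a := by
    by_contra! hno
    have hsub : (Finset.univ.filter fun x : G => orderOf x = 2) ⊆ {a ^ 2} := by
      intro x hx
      have hx2 := (Finset.mem_filter.1 hx).2
      have hxa := hno x hx2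
      rw [mem_zpowers_iff_mem_range_orderOf, ha] at hxa
      simp only [Finset.mem_image, Finset.mem_range] at hxa
      obtain ⟨k, hk, rfl⟩ := hxa
      rw [orderOf_pow, ha] at hx2
      interval_cases k <;> simp_all
    have := Finset.card_le_card hsub
    simp [h2] at this
  have hindex : (Subgroup.zpowers a).index = 2 := by
    have := (Subgroup.zpowers a).card_mul_index
    rw [Nat.card_zpowers, ha, hcard] at this
    lia
  have hconj := (Subgroup.normal_of_index_eq_two hindex).conj_mem a (Subgroup.mem_zpowers a) b
  have hord : orderOf (b * a * b⁻¹) = 4 := by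
    rw [← ha]
    exact MulEquiv.orderOf_eq (MulAut.conj b) a
  rw [mem_zpowers_iff_mem_range_orderOf, ha] at hconj
  simp only [Finset.mem_image, Finset.mem_range] at hconj
  obtain ⟨k, hk, hka⟩ := hconj
  rw [← hka, orderOf_pow, ha] at hord
  have hk13 : k = 1 ∨ k = 3 := by
    interval_cases k <;> simp_all
  have hb2 : b ^ 2 = 1 := hb ▸ pow_orderOf_eq_one b
  have ha4 : a ^ 4 = 1 := ha ▸ pow_orderOf_eq_one a
  rcases hk13 with rfl | rfl
  · refine nonempty_mulEquiv_of_commute hcard ha hb hba ?_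
    rw [pow_one, eq_mul_inv_iff_mul_eq] at hka
    exact hka
  · exfalso
    have hbab : b * a * b = a ^ 3 := by
      rw [hka, eq_mul_inv_iff_mul_eq, mul_assoc, ← sq, hb2, mul_one]
    have hpow : ∀ k : ℕ, a ^ k ∈ Subgroup.zpowers a := fun k => ⟨k, by simp⟩
    have hne : ∀ k : ℕ, a ^ k * b ∉ Subgroup.zpowers a := fun k h =>
      hba ((Subgroup.mul_mem_cancel_left _ (hpow k)).1 h)
    have ha1 : a ≠ 1 := by rintro rfl; simp at ha
    have ha2 : a ^ 2 ≠ 1 := fun h => by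
      have := orderOf_dvd_of_pow_eq_one h
      rw [ha] at this
      revert this
      decide
    have hinv : ∀ x : G, x ≠ 1 → x ^ 2 = 1 → orderOf x = 2 := fun x h h' => orderOf_eq_prime h' h
    have hsub : ({a ^ 2, b, a * b, a ^ 2 * b} : Finset G) ⊆
        Finset.univ.filter fun x : G => orderOf x = 2 := by
      intro x hx
      simp only [Finset.mem_insert, Finset.mem_singleton] at hx
      simp only [Finset.mem_filter, Finset.mem_univ, true_and]
      rcases hx with rfl | rfl | rfl | rfl
      · exact hinv _ ha2 (by rw [← pow_mul, ha4])
      · exact hb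
      · refine hinv _ (fun h => hne 1 (by rw [pow_one, h]; exact one_mem _)) ?_
        rw [sq, show a * b * (a * b) = a * (b * a * b) by group, hbab, ← pow_succ', ha4]
      · refine hinv _ (fun h => hne 2 (by rw [h]; exact one_mem _)) ?_
        have : b * a ^ 2 * b = a ^ 6 := by
          calc b * a ^ 2 * b = b * a * 1 * a * b := by simp only [sq, mul_one, mul_assoc]
            _ = (b * a * b) * (b * a * b) := by rw [← hb2]; simp only [sq, mul_assoc]
            _ = a ^ 6 := by rw [hbab, ← pow_add]
        rw [sq, show a ^ 2 * b * (a ^ 2 * b) = a ^ 2 * (b * a ^ 2 * b) by group, this,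
          ← pow_add, show 2 + 6 = 4 * 2 from rfl, pow_mul, ha4, one_pow]
    have hfour : ({a ^ 2, b, a * b, a ^ 2 * b} : Finset G).card = 4 := by
      have hab : a ≠ a ^ 2 := fun h => ha1 (by simpa [sq] using h)
      rw [Finset.card_insert_of_notMem, Finset.card_insert_of_notMem,
        Finset.card_insert_of_notMem, Finset.card_singleton]
      · simpa using hab
      · simp [ha1, ha2]
      · simp only [Finset.mem_insert, Finset.mem_singleton, not_or]
        exact ⟨fun h => hba (h ▸ hpow 2), fun h => hne 1 (by rw [pow_one, ← h]; exact hpow 2),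
          fun h => hne 2 (h ▸ hpow 2)⟩
    have := Finset.card_le_card hsub
    lia

theorem card_subgroupsOfCard_two_eq_three (hcard : Nat.card G = 8)
    (h4 : 3 ≤ (subgroupsOfCard G 4).card)
    (h : 2 * (subgroupsOfCard G 4).card + (subgroupsOfCard G 2).card = 9) :
    (subgroupsOfCard G 2).card = 3 := by
  classical
  have := Fintype.ofFinite G
  by_contra hne
  have h1 : (subgroupsOfCard G 2).card = 1 := by lia
  rw [card_subgroupsOfCard_two, Finset.card_eq_one] at h1
  obtain ⟨z, hz⟩ := h1
  have hzz : ∀ x : G, orderOf x = 2 ↔ x = z := fun x => by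
    simpa using Finset.ext_iff.1 hz x
  have := card_subgroupsOfCard_four_le hcard ((hzz z).2 rfl) fun H hH => by
    obtain ⟨x, hx⟩ := exists_prime_orderOf_dvd_card' (G := H) 2 (by rw [hH]; decide)
    rw [← Subgroup.orderOf_coe, hzz] at hx
    exact hx ▸ x.2
  lia

end

theorem sigma1_congr {G G' : Type*} [Group G] [Group G'] (e : G ≃* G') :
    sigma1 G = sigma1 G' := by
  unfold sigma1
  rw [Nat.card_congr e.toEquiv]
  congr 1
  refine finsum_eq_of_bijective e.mapSubgroup e.mapSubgroup.bijective fun H => ?_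
  exact congrArg _ (Nat.card_congr (H.equivMapOfInjective e.toMonoidHom e.injective).toEquiv)

theorem not_isCyclic_zmod_two_prod_zmod_four :
    ¬IsCyclic (Multiplicative (ZMod 2) × Multiplicative (ZMod 4)) := by
  rintro ⟨g, hg⟩
  have h8 := orderOf_eq_card_of_forall_mem_zpowers hg
  have h4 : g ^ 4 = 1 := by
    have : ∀ x : Multiplicative (ZMod 2) × Multiplicative (ZMod 4), x ^ 4 = 1 := by decide
    exact this g
  have := orderOf_dvd_of_pow_eq_one h4
  rw [h8] at this
  norm_num [Nat.card_prod] at this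

theorem sigma1_zmod_two_prod_zmod_four :
    sigma1 (Multiplicative (ZMod 2) × Multiplicative (ZMod 4)) = 2 + 11 / 8 := by
  set A := Multiplicative (ZMod 2) × Multiplicative (ZMod 4) with hA
  have hcard : Nat.card A = 8 := by simp [hA]
  have h2 : (subgroupsOfCard A 2).card = 3 := by
    rw [card_subgroupsOfCard_two]
    simp only [orderOf_eq_prime_iff]
    decide
  have hle : (subgroupsOfCard A 4).card ≤ 3 := by
    refine card_subgroupsOfCard_four_le (z := (1, Multiplicative.ofAdd 2)) hcard ?_ ?_
    · rw [orderOf_eq_prime_iff]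
      decide
    · intro H hH
      classical
      by_cases hx : ∃ x ∈ H, x ^ 2 ≠ 1
      · obtain ⟨x, hxH, hx⟩ := hx
        have : ∀ x : A, x ^ 2 ≠ 1 → x ^ 2 = (1, Multiplicative.ofAdd 2) := by decide
        exact this x hx ▸ pow_mem hxH 2
      · push Not at hx
        have hsub : Finset.univ.filter (· ∈ H) ⊆ Finset.univ.filter fun x : A => x ^ 2 = 1 :=
          Finset.monotone_filter_right _ fun x _ h => hx x h
        have heq := Finset.eq_of_subset_of_card_le hsub (by
          rw [← Fintype.card_subtype (· ∈ H), ← Nat.card_eq_fintype_card,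
            show Nat.card {x // x ∈ H} = 4 from hH]
          decide)
        have hmem : ((1, Multiplicative.ofAdd 2) : A) ∈
            Finset.univ.filter fun x : A => x ^ 2 = 1 := by decide
        rw [← heq] at hmem
        exact (Finset.mem_filter.1 hmem).2
  have hge := succ_le_card_subgroupsOfCard_of_not_isCyclic (G := A) (n := 2) Nat.prime_two hcard
    not_isCyclic_zmod_two_prod_zmod_four
  have h4 : (subgroupsOfCard A (2 ^ 2)).card = 3 := le_antisymm hle hge
  have h8 : (subgroupsOfCard A (2 ^ 3)).card = 1 := by
    rw [show 2 ^ 3 = Nat.card A from hcard.symm, card_subgroupsOfCard_card]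
  unfold sigma1
  rw [finsum_card_subgroup_eq Nat.prime_two (n := 3) hcard, hcard]
  simp only [Finset.sum_range_succ, Finset.sum_range_zero, h4, h8, pow_zero, pow_one, h2,
    card_subgroupsOfCard_one]
  norm_num

theorem stmt_7 (p : ℕ) (hp : p.Prime) (n : ℕ) (hn : 1 ≤ n)
    (G : Type*) [Group G] [Finite G] (hcard : Nat.card G = p ^ n)
    (hnc : ¬IsCyclic G) :
    sigma1 G = 2 + 11 / (Nat.card G : ℚ) ↔
      Nonempty (G ≃* Multiplicative (ZMod 2) × Multiplicative (ZMod 4)) := by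
  constructor
  · intro h
    have hpos : (Nat.card G : ℚ) ≠ 0 := Nat.cast_ne_zero.2 Nat.card_pos.ne'
    rw [sigma1, finsum_card_subgroup_eq hp hcard, div_eq_iff hpos, add_mul,
      div_mul_cancel₀ _ hpos] at h
    have h : ∑ i ∈ Finset.range (n + 1), (subgroupsOfCard G (p ^ i)).card * p ^ i =
        2 * p ^ n + 11 := by
      rw [hcard] at h
      exact_mod_cast h
    have hp2 := hp.two_le
    have htop : (subgroupsOfCard G (p ^ n)).card = 1 := hcard ▸ card_subgroupsOfCard_card
    obtain ⟨n, rfl⟩ := Nat.exists_eq_add_of_le' hn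
    have hmax := succ_le_card_subgroupsOfCard_of_not_isCyclic hp hcard hnc
    rw [Finset.sum_range_succ, Finset.sum_range_succ, htop, one_mul] at h
    have hmul := Nat.mul_le_mul_right (p ^ n) hmax
    rcases n with _ | _ | _ | n
    · have := Fact.mk hp
      exact absurd (isCyclic_of_prime_card (p := p) (by simpa using hcard)) hnc
    · exfalso
      have hup := card_mul_add_le_of_forall_le hp (⊥ : Subgroup G) (subgroupsOfCard G p)
        (fun _ _ => bot_le) (fun H hH => by simpa using mem_subgroupsOfCard.1 hH)
      rw [hcard] at hup
      simp only [Finset.sum_range_succ, Finset.sum_range_zero, card_subgroupsOfCard_one, zero_add,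
        pow_zero, pow_one, Subgroup.card_bot, mul_one, Nat.reduceAdd] at h hup hmax
      generalize (subgroupsOfCard G p).card = N at *
      obtain ⟨q, rfl⟩ := Nat.exists_eq_add_of_le' hp.one_le
      rw [Nat.add_sub_cancel] at hup
      have hN : N = q + 2 := by
        have : N * q ≤ (q + 2) * q := by nlinarith
        exact le_antisymm (Nat.le_of_mul_le_mul_right this (by lia)) hmax
      subst hN
      have hq : q = 9 := by nlinarith
      subst hq
      revert hp
      decide
    · have h1 := one_le_card_subgroupsOfCard hp hcard (i := 1) (by lia)
      simp only [Finset.sum_range_succ, Finset.sum_range_zero, card_subgroupsOfCard_one, zero_add,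
        pow_zero, pow_one, one_mul, Nat.reduceAdd] at h hmax hmul h1
      obtain rfl : p = 2 := by
        by_contra hne
        have h3 : 3 ≤ p := by lia
        have := Nat.mul_le_mul_right p h1
        nlinarith
      norm_num at h hmax hcard
      exact nonempty_mulEquiv_of_card_involutions hcard hnc
        (card_subgroupsOfCard_two_eq_three hcard hmax (by lia))
    · exfalso
      have h1 := one_le_card_subgroupsOfCard hp hcard (i := n + 1 + 1) (by lia)
      rw [Finset.sum_range_succ] at h
      have hm := Nat.mul_le_mul_right (p ^ (n + 1 + 1)) h1
      have e1 : 2 ^ 2 ≤ p ^ (n + 1 + 1) :=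
        (Nat.pow_le_pow_right two_pos (by lia)).trans (Nat.pow_le_pow_left hp2 _)
      have e2 : 2 ^ 3 ≤ p ^ (n + 1 + 1 + 1) :=
        (Nat.pow_le_pow_right two_pos (by lia)).trans (Nat.pow_le_pow_left hp2 _)
      have e3 : (p + 1) * p ^ (n + 1 + 1 + 1) =
          p ^ (n + 1 + 1 + 1 + 1) + p ^ (n + 1 + 1 + 1) := by ring
      rw [e3] at hmul
      lia
  · rintro ⟨e⟩
    have h8 : Nat.card G = 8 := by rw [Nat.card_congr e.toEquiv]; simp
    rw [sigma1_congr e, sigma1_zmod_two_prod_zmod_four, h8]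
    norm_num
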